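/- arXiv:math/0109202 — 4 statements merged into one kernel-verified Lean document; each statement's English description precedes it below -/
import Mathlib

section
/- Isolated symmetric points on momentum level sets are relative equilibria (Theorem 3.6): Let n ≥ 2 and λ : Fin n → ℝ. Let M be the set of configurations y : Fin n → ℝ³ with ‖y i‖ = 1 for all i and y i ≠ y j for i ≠ j. Let Γ be a collection of pairs (A, σ), with A a linear isometry of ℝ³ and σ a permutation of Fin n, containing the identity, closed under the composition (A, σ) · (B, ρ) = (A ∘ B, ρ ∘ σ) and under inverses, such that every (A, σ) ∈ Γ satisfies λ ∘ σ = λ or λ ∘ σ = −λ; let Fix(Γ) = { y ∈ M | ∀ (A, σ) ∈ Γ, ∀ i, A (y (σ i)) = y i }. Let x ∈ Fix(Γ), μ = Φ(x), and suppose x is an isolated point of Fix(Γ) ∩ Φ⁻¹(μ). Then x is a relative equilibrium: there exists ξ ∈ ℝ³ such that for every v : Fin n → ℝ³ with ⟪v i, x i⟫ = 0 for all i, fderiv ℝ H x v = ⟪ξ, Σ_i λ i • v i⟫. If in addition every (A, σ) ∈ Γ with λ ∘ σ = ε · λ (ε ∈ {1, −1}) satisfies ε · det A = 1, then x is a fixed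 equilibrium: fderiv ℝ H x v = 0 for all such tangent vectors v. -/
open scoped RealInnerProductSpace BigOperators

noncomputable section

/-- Euclidean 3-space. -/
abbrev R3 : Type := EuclideanSpace ℝ (Fin 3)

/-- The vector of `R3` with the given coordinates. -/
def v3 (a b c : ℝ) : R3 := (WithLp.equiv 2 (Fin 3 → ℝ)).symm ![a, b, c]

/-- Cross product on `R3`. -/
def cross (u v : R3) : R3 :=
  v3 (u 1 * v 2 - u 2 * v 1) (u 2 * v 0 - u 0 * v 2) (u 0 * v 1 - u 1 * v 0)

/-- The point-vortex vector field on the sphere: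
`F(x) i = Σ_{j ≠ i} (λ j / (1 − ⟪x i, x j⟫)) • (x j × x i)`. -/
def vortexF {ι : Type} [Fintype ι] [DecidableEq ι] (lam : ι → ℝ) (x : ι → R3) (i : ι) : R3 :=
  ∑ j ∈ Finset.univ.filter (fun j => j ≠ i), (lam j / (1 - ⟪x i, x j⟫)) • cross (x j) (x i)

/-- The point-vortex Hamiltonian `H(y) = Σ_{i<j} λ i λ j log ‖y i − y j‖²`. -/
def vortexH (n : ℕ) (lam : Fin n → ℝ) (y : Fin n → R3) : ℝ :=
  ∑ p ∈ Finset.univ.filter (fun p : Fin n × Fin n => p.1 < p.2),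
    lam p.1 * lam p.2 * Real.log (‖y p.1 - y p.2‖ ^ 2)

/-- The centre of vorticity `Φ(y) = Σ_i λ i • y i`. -/
def vorticityCentre (n : ℕ) (lam : Fin n → ℝ) (y : Fin n → R3) : R3 := ∑ i, lam i • y i

/-- The fixed point set of a collection `Γ` of symmetries inside the configuration space. -/
def fixSet (n : ℕ) (Γ : Set ((R3 ≃ₗᵢ[ℝ] R3) × Equiv.Perm (Fin n))) : Set (Fin n → R3) :=
  { y | (∀ i, ‖y i‖ = 1) ∧ (∀ i j, i ≠ j → y i ≠ y j) ∧
        ∀ p ∈ Γ, ∀ i, p.1 (y (p.2 i)) = y i }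

open Filter Topology

lemma R3.inner_eq (a b : R3) : ⟪a, b⟫ = a 0 * b 0 + a 1 * b 1 + a 2 * b 2 := by
  simp [PiLp.inner_apply, Fin.sum_univ_three]; ring

lemma inner_cross (a b c : R3) : ⟪cross a b, c⟫ = ⟪a, cross b c⟫ := by
  simp [R3.inner_eq, cross, v3]; ring

lemma inner_cross_self_right (a b : R3) : ⟪cross a b, b⟫ = 0 := by
  simp [R3.inner_eq, cross, v3]; ring

lemma cross_sub_left (a b c : R3) : cross (a - b) c = cross a c - cross b c := by
  ext i; fin_cases i <;> simp [cross, v3] <;> ring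

lemma inner_self_cross (a c : R3) : ⟪a, cross a c⟫ = 0 := by
  simp [R3.inner_eq, cross, v3]; ring

lemma inner_cross_self_left (a c : R3) : ⟪cross a c, a⟫ = 0 := by
  simp [R3.inner_eq, cross, v3]; ring

lemma inner_cross_cross (a b c : R3) :
    ⟪cross a b, cross c b⟫ = ⟪a, c⟫ * ⟪b, b⟫ - ⟪a, b⟫ * ⟪c, b⟫ := by
  simp only [R3.inner_eq]
  simp [cross, v3]
  ring

lemma inner_cross_eq_det (a b c : R3) :
    ⟪cross a b, c⟫ = (EuclideanSpace.basisFun (Fin 3) ℝ).toBasis.det ![a, b, c] := by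
  rw [Module.Basis.det_apply, Matrix.det_fin_three]
  simp [R3.inner_eq, cross, v3, Module.Basis.toMatrix_apply]; ring

lemma inner_cross_map (A : R3 ≃ₗᵢ[ℝ] R3) (a b c : R3) :
    ⟪cross (A a) (A b), A c⟫ =
      LinearMap.det (A.toLinearEquiv : R3 →ₗ[ℝ] R3) * ⟪cross a b, c⟫ := by
  rw [inner_cross_eq_det, inner_cross_eq_det, ← Module.Basis.det_comp]
  congr 1
  ext i
  fin_cases i <;> rfl

/-- If the derivative of `f` at `a` is onto and `a` is isolated in its fibre, then the derivative
is injective. -/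
lemma HasStrictFDerivAt.ker_eq_bot_of_isolated {E F : Type*} [NormedAddCommGroup E]
    [NormedSpace ℝ E] [FiniteDimensional ℝ E] [NormedAddCommGroup F] [NormedSpace ℝ F]
    [FiniteDimensional ℝ F] {f : E → F} {f' : E →L[ℝ] F} {a : E}
    (hf : HasStrictFDerivAt f f' a) (hf' : f'.range = ⊤)
    (h : ∀ᶠ u in 𝓝 a, f u = f a → u = a) : f'.ker = ⊥ := by
  have := FiniteDimensional.complete ℝ E
  have hd := (hf.to_implicitFunction hf').hasFDerivAt
  have hc : Tendsto (hf.implicitFunction f f' hf' (f a)) (𝓝 0) (𝓝 a) := by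
    simpa using hd.continuousAt.tendsto
  have hm : ∀ᶠ k : f'.ker in 𝓝 0, f (hf.implicitFunction f f' hf' (f a) k) = f a :=
    (Continuous.prodMk_right (f a)).continuousAt.eventually (hf.map_implicitFunction_eq hf')
  have hconst : hf.implicitFunction f f' hf' (f a) =ᶠ[𝓝 0] fun _ => a := by
    filter_upwards [hc.eventually h, hm] with k hk hk' using hk hk'
  have h0 := hd.unique ((hasFDerivAt_const a (0 : f'.ker)).congr_of_eventuallyEq hconst)
  rw [Submodule.eq_bot_iff]
  intro u hu
  simpa using DFunLike.congr_fun h0 (⟨u, hu⟩ : f'.ker)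

section VortexHamiltonian

variable {n : ℕ} (lam : Fin n → ℝ) (x : Fin n → R3)

/-- The coefficient of the interaction of vortices `i` and `j` in the derivative of `vortexH`. -/
def interaction (i j : Fin n) : ℝ := 2 * (lam i * lam j) / ‖x i - x j‖ ^ 2

lemma interaction_comm (i j : Fin n) : interaction lam x i j = interaction lam x j i := by
  simp only [interaction, norm_sub_rev (x i), mul_comm (lam i)]

/-- The Euclidean gradient of `vortexH`. -/
def vortexGrad (i : Fin n) : R3 := ∑ j, interaction lam x i j • (x i - x j)

variable {x}

lemma fderiv_vortexH (hx : ∀ i j, i ≠ j → x i ≠ x j) (v : Fin n → R3) :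
    fderiv ℝ (vortexH n lam) x v =
      ∑ p ∈ Finset.univ.filter (fun p : Fin n × Fin n => p.1 < p.2),
        interaction lam x p.1 p.2 * ⟪x p.1 - x p.2, v p.1 - v p.2⟫ := by
  have hd (i : Fin n) : HasFDerivAt (fun y : Fin n → R3 => y i)
      (ContinuousLinearMap.proj (R := ℝ) (φ := fun _ : Fin n => R3) i) x := hasFDerivAt_apply i x
  have key := HasFDerivAt.fun_sum (x := x)
    (u := Finset.univ.filter (fun p : Fin n × Fin n => p.1 < p.2)) fun p hp =>
      ((((hd p.1).sub (hd p.2)).norm_sq.log (by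
        have := hx p.1 p.2 (Finset.mem_filter.1 hp).2.ne
        simpa [sub_eq_zero] using this)).const_mul (lam p.1 * lam p.2))
  have hH : HasFDerivAt (vortexH n lam) _ x := key
  rw [hH.fderiv, sum_apply]
  refine Finset.sum_congr rfl fun p _ => ?_
  simp [interaction, inner_sub_left, inner_sub_right]
  ring

lemma sum_lt_eq_half_sum (s : Fin n → Fin n → ℝ) (hs : ∀ i j, s i j = s j i)
    (h0 : ∀ i, s i i = 0) :
    ∑ p ∈ Finset.univ.filter (fun p : Fin n × Fin n => p.1 < p.2), s p.1 p.2 =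
      (∑ i, ∑ j, s i j) / 2 := by
  have hswap : ∑ i, ∑ j, (if j < i then s i j else 0) =
      ∑ i, ∑ j, (if i < j then s i j else 0) := by
    rw [Finset.sum_comm]
    simp only [hs]
  have hsplit : ∑ i, ∑ j, s i j = ∑ i, ∑ j, (if i < j then s i j else 0) +
      ∑ i, ∑ j, (if j < i then s i j else 0) := by
    simp only [← Finset.sum_add_distrib]
    refine Finset.sum_congr rfl fun i _ => Finset.sum_congr rfl fun j _ => ?_
    rcases lt_trichotomy i j with h | rfl | h
    · simp [h, h.not_gt]
    · simp [h0]
    · simp [h, h.not_gt]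
  rw [Finset.sum_filter, Fintype.sum_prod_type, hsplit, hswap]
  ring

lemma fderiv_vortexH_eq_sum_inner (hx : ∀ i j, i ≠ j → x i ≠ x j) (v : Fin n → R3) :
    fderiv ℝ (vortexH n lam) x v = ∑ i, ⟪vortexGrad lam x i, v i⟫ := by
  rw [fderiv_vortexH lam hx,
    sum_lt_eq_half_sum (fun i j => interaction lam x i j * ⟪x i - x j, v i - v j⟫)
      (fun i j => by
        rw [interaction_comm, ← neg_sub (x j), ← neg_sub (v j), inner_neg_neg]) (by simp)]
  have h1 : ∑ i, ∑ j, interaction lam x i j * ⟪x i - x j, v i⟫ =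
      ∑ i, ⟪vortexGrad lam x i, v i⟫ := by
    simp only [vortexGrad, sum_inner, real_inner_smul_left]
  have h2 : ∑ i, ∑ j, interaction lam x i j * ⟪x i - x j, v j⟫ =
      -∑ i, ∑ j, interaction lam x i j * ⟪x i - x j, v i⟫ := by
    rw [Finset.sum_comm, ← Finset.sum_neg_distrib]
    refine Finset.sum_congr rfl fun i _ => ?_
    rw [← Finset.sum_neg_distrib]
    refine Finset.sum_congr rfl fun j _ => ?_
    rw [interaction_comm, ← neg_sub (x i), inner_neg_left]
    ring
  simp only [inner_sub_right _ (v _), mul_sub, Finset.sum_sub_distrib]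
  rw [h2, h1]
  ring

lemma fderiv_vortexH_cross (hx : ∀ i j, i ≠ j → x i ≠ x j) (c : R3) :
    fderiv ℝ (vortexH n lam) x (fun i => cross (x i) c) = 0 := by
  rw [fderiv_vortexH lam hx]
  refine Finset.sum_eq_zero fun p _ => ?_
  rw [← cross_sub_left, inner_self_cross, mul_zero]

/-- Configurations whose interacting vortices are all pairwise parallel are critical. -/
lemma fderiv_vortexH_of_parallel (hx : ∀ i j, i ≠ j → x i ≠ x j)
    (hpar : ∀ i j, lam i ≠ 0 → lam j ≠ 0 → x i = x j ∨ x i = -x j)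
    (v : Fin n → R3) (hv : ∀ i, ⟪v i, x i⟫ = 0) : fderiv ℝ (vortexH n lam) x v = 0 := by
  rw [fderiv_vortexH_eq_sum_inner lam hx]
  refine Finset.sum_eq_zero fun i _ => ?_
  rw [vortexGrad, sum_inner]
  refine Finset.sum_eq_zero fun j _ => ?_
  rw [real_inner_smul_left]
  by_cases h1 : lam i = 0
  · simp [interaction, h1]
  by_cases h2 : lam j = 0
  · simp [interaction, h2]
  rcases hpar i j h1 h2 with h | h
  · simp [h]
  · rw [← neg_eq_iff_eq_neg.2 h, inner_sub_left, inner_neg_left, real_inner_comm, hv i]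
    simp

end VortexHamiltonian

section Symmetry

variable {n : ℕ} (lam : Fin n → ℝ) (Γ : Set ((R3 ≃ₗᵢ[ℝ] R3) × Equiv.Perm (Fin n)))
  (x : Fin n → R3)

/-- Tangent vectors at `x` to the fixed point set of `Γ`. -/
def fixTangent : Submodule ℝ (Fin n → R3) where
  carrier := {u | (∀ i, ⟪u i, x i⟫ = 0) ∧ ∀ p ∈ Γ, ∀ i, p.1 (u (p.2 i)) = u i}
  add_mem' := fun ha hb => ⟨fun i => by simp [inner_add_left, ha.1 i, hb.1 i],
    fun p hp i => by simp [ha.2 p hp i, hb.2 p hp i]⟩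
  zero_mem' := by simp
  smul_mem' := fun c u hu => ⟨fun i => by simp [real_inner_smul_left, hu.1 i],
    fun p hp i => by simp [hu.2 p hp i]⟩

/-- The momentum values fixed by the twisted action `w ↦ ε • A w` of `Γ`. -/
def fixMomentum : Submodule ℝ R3 where
  carrier := {w | ∀ p ∈ Γ, ∀ ε : ℝ, (ε = 1 ∨ ε = -1) →
    (∀ i, lam (p.2 i) = ε * lam i) → p.1 w = ε • w}
  add_mem' := fun ha hb p hp ε hε h => by simp [ha p hp ε hε h, hb p hp ε hε h]
  zero_mem' := by simp
  smul_mem' := fun c w hw p hp ε hε h => by simp [hw p hp ε hε h, smul_comm c ε]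

/-- The centre of vorticity as a continuous linear map. -/
def vorticityCentreL : (Fin n → R3) →L[ℝ] R3 :=
  ∑ i, lam i • ContinuousLinearMap.proj (R := ℝ) (φ := fun _ : Fin n => R3) i

lemma vorticityCentreL_apply (y : Fin n → R3) :
    vorticityCentreL lam y = vorticityCentre n lam y := by
  simp [vorticityCentreL, vorticityCentre]

/-- The adjoint of the derivative of the centre of vorticity at `x`. -/
def momentumField (w : R3) (i : Fin n) : R3 := lam i • (w - ⟪w, x i⟫ • x i)

/-- The tangential part of the gradient of `vortexH`. -/
def tangentGrad (i : Fin n) : R3 :=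
  vortexGrad lam x i - ⟪vortexGrad lam x i, x i⟫ • x i

/-- The lift of tangent vectors at `x` back to the product of unit spheres. -/
def sphereLift (u : Fin n → R3) (i : Fin n) : R3 :=
  (√(1 + ‖u i‖ ^ 2))⁻¹ • (x i + u i)

variable {lam Γ x}

lemma vorticityCentre_mem_fixMomentum {y : Fin n → R3}
    (hy : ∀ p ∈ Γ, ∀ i, p.1 (y (p.2 i)) = y i) :
    vorticityCentre n lam y ∈ fixMomentum lam Γ := by
  intro p hp ε hε h
  have hε2 : ε * ε = 1 := by rcases hε with rfl | rfl <;> norm_num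
  rw [vorticityCentre, map_sum, ← Equiv.sum_comp p.2, Finset.smul_sum]
  refine Finset.sum_congr rfl fun i _ => ?_
  rw [map_smul, hy p hp, h, mul_smul]

lemma inner_momentumField {w : R3} {i : Fin n} {v : R3} (hv : ⟪v, x i⟫ = 0) :
    ⟪momentumField lam x w i, v⟫ = lam i * ⟪w, v⟫ := by
  rw [real_inner_comm] at hv
  simp [momentumField, real_inner_smul_left, inner_sub_left, hv]

lemma inner_tangentGrad {i : Fin n} {v : R3} (hv : ⟪v, x i⟫ = 0) :
    ⟪tangentGrad lam x i, v⟫ = ⟪vortexGrad lam x i, v⟫ := by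
  rw [real_inner_comm] at hv
  simp [tangentGrad, real_inner_smul_left, inner_sub_left, hv]

lemma momentumField_mem_fixTangent (hx : x ∈ fixSet n Γ)
    (hlam : ∀ p ∈ Γ, ∃ ε : ℝ, (ε = 1 ∨ ε = -1) ∧ ∀ i, lam (p.2 i) = ε * lam i)
    {w : R3} (hw : w ∈ fixMomentum lam Γ) : momentumField lam x w ∈ fixTangent Γ x := by
  refine ⟨fun i => ?_, fun p hp i => ?_⟩
  · simp [momentumField, real_inner_smul_left, inner_sub_left, hx.1 i]
  · obtain ⟨ε, hε, h⟩ := hlam p hp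
    have hA := hw p hp ε hε h
    have hin : ⟪w, x (p.2 i)⟫ = ε * ⟪w, x i⟫ := by
      rw [← p.1.inner_map_map, hA, hx.2.2 p hp i, real_inner_smul_left]
    rw [momentumField, momentumField, map_smul, map_sub, map_smul, hx.2.2 p hp i, h, hA, hin,
      mul_smul ε ⟪w, x i⟫, ← smul_sub, smul_smul]
    rcases hε with rfl | rfl <;> simp

lemma vortexGrad_equivariant (hx : x ∈ fixSet n Γ)
    (hlam : ∀ p ∈ Γ, ∃ ε : ℝ, (ε = 1 ∨ ε = -1) ∧ ∀ i, lam (p.2 i) = ε * lam i)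
    {p} (hp : p ∈ Γ) (i : Fin n) : p.1 (vortexGrad lam x (p.2 i)) = vortexGrad lam x i := by
  obtain ⟨ε, hε, h⟩ := hlam p hp
  have hε2 : ε * ε = 1 := by rcases hε with rfl | rfl <;> norm_num
  rw [vortexGrad, vortexGrad, ← Equiv.sum_comp p.2, map_sum]
  refine Finset.sum_congr rfl fun j _ => ?_
  have hsub : p.1 (x (p.2 i) - x (p.2 j)) = x i - x j := by
    rw [map_sub, hx.2.2 p hp, hx.2.2 p hp]
  have hnorm : ‖x (p.2 i) - x (p.2 j)‖ = ‖x i - x j‖ := by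
    rw [← hsub, p.1.norm_map]
  rw [map_smul, hsub, interaction, interaction, hnorm, h, h]
  congr 2
  linear_combination 2 * lam i * lam j * hε2

lemma tangentGrad_mem_fixTangent (hx : x ∈ fixSet n Γ)
    (hlam : ∀ p ∈ Γ, ∃ ε : ℝ, (ε = 1 ∨ ε = -1) ∧ ∀ i, lam (p.2 i) = ε * lam i) :
    tangentGrad lam x ∈ fixTangent Γ x := by
  refine ⟨fun i => ?_, fun p hp i => ?_⟩
  · simp [tangentGrad, real_inner_smul_left, inner_sub_left, hx.1 i]
  · have hG := vortexGrad_equivariant hx hlam hp i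
    have hin : ⟪vortexGrad lam x (p.2 i), x (p.2 i)⟫ = ⟪vortexGrad lam x i, x i⟫ := by
      rw [← p.1.inner_map_map, hG, hx.2.2 p hp i]
    rw [tangentGrad, tangentGrad, map_sub, map_smul, hx.2.2 p hp i, hG, hin]

lemma norm_sphereLift (hx : ∀ i, ‖x i‖ = 1) {u : Fin n → R3} (hu : ∀ i, ⟪u i, x i⟫ = 0)
    (i : Fin n) : ‖sphereLift x u i‖ = 1 := by
  have h : ‖x i + u i‖ = √(1 + ‖u i‖ ^ 2) := by
    rw [eq_comm, Real.sqrt_eq_iff_mul_self_eq (by positivity) (by positivity), ← sq,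
      norm_add_sq_real, hx i, real_inner_comm, hu i]
    ring
  have hpos : 0 < √(1 + ‖u i‖ ^ 2) := by positivity
  rw [sphereLift, norm_smul, h, norm_inv, Real.norm_of_nonneg hpos.le, inv_mul_cancel₀ hpos.ne']

lemma sphereLift_zero : sphereLift x 0 = x := by
  ext1 i; simp [sphereLift]

lemma sphereLift_eq_self {u : Fin n → R3} (hu : ∀ i, ⟪u i, x i⟫ = 0) (h : sphereLift x u = x) :
    u = 0 := by
  ext1 i
  have h1 : ⟪u i, sphereLift x u i⟫ = 0 := by rw [h, hu i]
  have hpos : 0 < √(1 + ‖u i‖ ^ 2) := by positivity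
  rw [sphereLift, real_inner_smul_right, inner_add_right, hu i, zero_add] at h1
  simpa using (mul_eq_zero.1 h1).resolve_left (inv_ne_zero hpos.ne')

lemma sphereLift_equivariant (hx : x ∈ fixSet n Γ) {u : Fin n → R3} (hu : u ∈ fixTangent Γ x)
    {p} (hp : p ∈ Γ) (i : Fin n) : p.1 (sphereLift x u (p.2 i)) = sphereLift x u i := by
  have h : ‖u (p.2 i)‖ = ‖u i‖ := by rw [← hu.2 p hp i, p.1.norm_map]
  rw [sphereLift, sphereLift, map_smul, map_add, hx.2.2 p hp, hu.2 p hp, h]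

lemma hasStrictFDerivAt_sphereLift :
    HasStrictFDerivAt (sphereLift x) (ContinuousLinearMap.id ℝ (Fin n → R3)) 0 := by
  rw [hasStrictFDerivAt_pi']
  intro i
  have hp : HasStrictFDerivAt (fun u : Fin n → R3 => u i)
      (ContinuousLinearMap.proj (R := ℝ) (φ := fun _ : Fin n => R3) i) 0 :=
    hasStrictFDerivAt_apply i 0
  have hs := (((hasStrictFDerivAt_norm_sq _).comp 0 hp).const_add 1).sqrt (by simp)
  have := ((hasStrictDerivAt_inv (by simp)).comp_hasStrictFDerivAt 0 hs).smul (hp.const_add (x i))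
  refine this.congr_fderiv ?_
  ext v
  simp

lemma eq_zero_of_momentumField_eq_zero (hx : ∀ i, ‖x i‖ = 1) {i j : Fin n} (hi : lam i ≠ 0)
    (hj : lam j ≠ 0) (hij : x i ≠ x j) (hij' : x i ≠ -x j) {w : R3}
    (hw : momentumField lam x w = 0) : w = 0 := by
  have h (k : Fin n) (hk : lam k ≠ 0) : w = ⟪w, x k⟫ • x k := by
    have := congr_fun hw k
    simpa [momentumField, hk, sub_eq_zero] using this
  have hn (k : Fin n) (hk : lam k ≠ 0) : ‖w‖ = |⟪w, x k⟫| := by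
    conv_lhs => rw [h k hk]
    rw [norm_smul, hx k, mul_one, Real.norm_eq_abs]
  by_contra hw0
  have ha : ⟪w, x i⟫ ≠ 0 := fun h0 => hw0 (by rw [h i hi, h0, zero_smul])
  have heq := (h i hi).symm.trans (h j hj)
  rcases abs_eq_abs.1 ((hn i hi).symm.trans (hn j hj)) with h1 | h1
  · rw [← h1] at heq
    exact hij (smul_right_injective _ ha heq)
  · rw [← neg_eq_iff_eq_neg.2 h1, neg_smul, ← smul_neg] at heq
    exact hij' (smul_right_injective _ ha heq)

/-- At a point isolated in `Fix(Γ) ∩ Φ⁻¹(μ)` where `Φ` is a submersion, `dΦ` is injective on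
the tangent space of `Fix(Γ)`. -/
lemma eq_zero_of_isolated (hx : x ∈ fixSet n Γ)
    (hlam : ∀ p ∈ Γ, ∃ ε : ℝ, (ε = 1 ∨ ε = -1) ∧ ∀ i, lam (p.2 i) = ε * lam i)
    (hreg : ∀ w, momentumField lam x w = 0 → w = 0)
    (hisol : ∀ᶠ y in 𝓝 x, y ∈ fixSet n Γ → vorticityCentre n lam y = vorticityCentre n lam x →
      y = x)
    {u : Fin n → R3} (hu : u ∈ fixTangent Γ x) (hu0 : vorticityCentre n lam u = 0) : u = 0 := by
  set P := (fixMomentum lam Γ).orthogonalProjectionOnto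
  have hsub : HasStrictFDerivAt (fun u : fixTangent Γ x => (u : Fin n → R3))
      (fixTangent Γ x).subtypeL 0 := (fixTangent Γ x).subtypeL.hasStrictFDerivAt
  have hf : HasStrictFDerivAt
      (fun u : fixTangent Γ x => P (vorticityCentreL lam (sphereLift x u)))
      (P ∘L vorticityCentreL lam ∘L (fixTangent Γ x).subtypeL) 0 :=
    P.hasStrictFDerivAt.comp _ ((vorticityCentreL lam).hasStrictFDerivAt.comp _
      (hasStrictFDerivAt_sphereLift.comp (0 : fixTangent Γ x) hsub))
  have hP {y : Fin n → R3} (hy : ∀ p ∈ Γ, ∀ i, p.1 (y (p.2 i)) = y i) :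
      ((P (vorticityCentreL lam y) : fixMomentum lam Γ) : R3) = vorticityCentre n lam y := by
    rw [vorticityCentreL_apply]
    exact (fixMomentum lam Γ).starProjection_eq_self_iff.2 (vorticityCentre_mem_fixMomentum hy)
  have hsurj : (P ∘L vorticityCentreL lam ∘L (fixTangent Γ x).subtypeL).range = ⊤ := by
    rw [← Submodule.orthogonal_eq_bot_iff, Submodule.eq_bot_iff]
    rintro ⟨w, hw⟩ hperp
    have hmem := momentumField_mem_fixTangent hx hlam hw
    have h0 : ⟪vorticityCentre n lam (momentumField lam x w), w⟫ = 0 := by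
      rw [← hP hmem.2]
      exact (Submodule.mem_orthogonal _ _).1 hperp _ ⟨⟨_, hmem⟩, rfl⟩
    have hsum : ∑ i, ‖momentumField lam x w i‖ ^ 2 = 0 := by
      rw [← h0, vorticityCentre, sum_inner]
      refine Finset.sum_congr rfl fun i _ => ?_
      rw [← real_inner_self_eq_norm_sq, inner_momentumField (hmem.1 i), real_inner_smul_left,
        real_inner_comm]
    rw [Finset.sum_eq_zero_iff_of_nonneg fun _ _ => by positivity] at hsum
    simpa using hreg w (funext fun i => by simpa using hsum i (Finset.mem_univ i))
  have hlift : Tendsto (fun u : fixTangent Γ x => sphereLift x u) (𝓝 0) (𝓝 x) := by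
    have := ((hasStrictFDerivAt_sphereLift (x := x)).comp
      (0 : fixTangent Γ x) hsub).continuousAt.tendsto
    simpa [sphereLift_zero] using this
  have hne : ∀ᶠ y in 𝓝 x, ∀ i j, i ≠ j → y i ≠ y j := by
    simp only [eventually_all]
    intro i j hij
    exact ((continuous_apply i).continuousAt.ne_iff_eventually_ne
      (continuous_apply j).continuousAt).1 (hx.2.1 i j hij)
  have hker := hf.ker_eq_bot_of_isolated hsurj (by
    filter_upwards [hlift.eventually hisol, hlift.eventually hne] with u h1 h2 h3
    refine Subtype.ext (sphereLift_eq_self u.2.1 (h1 ⟨norm_sphereLift hx.1 u.2.1, h2,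
      fun p hp => sphereLift_equivariant hx u.2 hp⟩ ?_))
    have h4 := congr_arg (Subtype.val (p := (· ∈ fixMomentum lam Γ))) h3
    simp only [Submodule.coe_zero, sphereLift_zero] at h4
    rwa [hP fun p hp => sphereLift_equivariant hx u.2 hp, hP hx.2.2] at h4)
  have hmem : (⟨u, hu⟩ : fixTangent Γ x) ∈
      (P ∘L vorticityCentreL lam ∘L (fixTangent Γ x).subtypeL).ker :=
    Subtype.ext ((hP hu.2).trans hu0)
  rw [hker, Submodule.mem_bot] at hmem
  exact congr_arg Subtype.val hmem

/-- If `dΦ` is injective on the tangent space of `Fix(Γ)`, then `x` has a `Γ`-fixed Lagrange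
multiplier. -/
lemma exists_multiplier (hx : x ∈ fixSet n Γ)
    (hlam : ∀ p ∈ Γ, ∃ ε : ℝ, (ε = 1 ∨ ε = -1) ∧ ∀ i, lam (p.2 i) = ε * lam i)
    (hinj : ∀ u ∈ fixTangent Γ x, vorticityCentre n lam u = 0 → u = 0) :
    ∃ ξ ∈ fixMomentum lam Γ, ∀ v : Fin n → R3, (∀ i, ⟪v i, x i⟫ = 0) →
      fderiv ℝ (vortexH n lam) x v = ⟪ξ, ∑ i, lam i • v i⟫ := by
  let D : fixTangent Γ x →ₗ[ℝ] fixMomentum lam Γ :=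
    ((vorticityCentreL lam : (Fin n → R3) →ₗ[ℝ] R3).comp (fixTangent Γ x).subtype).codRestrict _
      fun u => by
        simpa [vorticityCentreL_apply] using vorticityCentre_mem_fixMomentum u.2.2
  have hD (u : fixTangent Γ x) : (D u : R3) = vorticityCentre n lam u :=
    vorticityCentreL_apply lam _
  have hDker : D.ker = ⊥ := by
    rw [Submodule.eq_bot_iff]
    intro u hu
    exact Subtype.ext (hinj u u.2 (by rw [← hD, LinearMap.mem_ker.1 hu, Submodule.coe_zero]))
  obtain ⟨L, hL⟩ := D.exists_leftInverse_of_injective hDker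
  let φ : StrongDual ℝ (fixMomentum lam Γ) :=
    LinearMap.toContinuousLinearMap
      ((fderiv ℝ (vortexH n lam) x : (Fin n → R3) →ₗ[ℝ] ℝ) ∘ₗ (fixTangent Γ x).subtype ∘ₗ L)
  obtain ⟨ξ, hξ⟩ : ∃ ξ, φ = InnerProductSpace.toDual ℝ _ ξ :=
    ⟨_, ((InnerProductSpace.toDual ℝ _).apply_symm_apply φ).symm⟩
  have hfix {u : Fin n → R3} (hu : u ∈ fixTangent Γ x) :
      fderiv ℝ (vortexH n lam) x u = ⟪(ξ : R3), vorticityCentre n lam u⟫ := by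
    have h1 := DFunLike.congr_fun hξ (D ⟨u, hu⟩)
    have h2 : L (D ⟨u, hu⟩) = ⟨u, hu⟩ := LinearMap.congr_fun hL _
    rw [InnerProductSpace.toDual_apply_apply, Submodule.coe_inner, hD] at h1
    rw [← h1]
    simp [φ, h2]
  have hsum {ζ : R3} {v : Fin n → R3} (hv : ∀ i, ⟪v i, x i⟫ = 0) :
      fderiv ℝ (vortexH n lam) x v - ⟪ζ, vorticityCentre n lam v⟫ =
        ∑ i, ⟪tangentGrad lam x i - momentumField lam x ζ i, v i⟫ := by
    rw [fderiv_vortexH_eq_sum_inner lam hx.2.1, vorticityCentre, inner_sum,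
      ← Finset.sum_sub_distrib]
    refine Finset.sum_congr rfl fun i _ => ?_
    rw [inner_sub_left, inner_tangentGrad (hv i), inner_momentumField (hv i),
      real_inner_smul_right]
  have hd : tangentGrad lam x - momentumField lam x ξ ∈ fixTangent Γ x :=
    sub_mem (tangentGrad_mem_fixTangent hx hlam) (momentumField_mem_fixTangent hx hlam ξ.2)
  have hd0 : ∑ i, ‖tangentGrad lam x i - momentumField lam x ξ i‖ ^ 2 = 0 := by
    have := hsum (ζ := ξ) hd.1
    rw [hfix hd, sub_self] at this
    simpa using this.symm
  rw [Finset.sum_eq_zero_iff_of_nonneg fun _ _ => by positivity] at hd0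
  refine ⟨ξ, ξ.2, fun v hv => ?_⟩
  rw [← sub_eq_zero]
  refine (hsum hv).trans (Finset.sum_eq_zero fun i hi => ?_)
  rw [norm_eq_zero.1 (pow_eq_zero_iff two_ne_zero |>.1 (hd0 i hi)), inner_zero_left]

/-- For a group of symplectic symmetries, a `Γ`-fixed Lagrange multiplier of a point where `dΦ` is
injective on the tangent space of `Fix(Γ)` generates the trivial rotation. -/
lemma cross_multiplier_eq_zero (hx : x ∈ fixSet n Γ)
    (hlam : ∀ p ∈ Γ, ∃ ε : ℝ, (ε = 1 ∨ ε = -1) ∧ ∀ i, lam (p.2 i) = ε * lam i)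
    (hinj : ∀ u ∈ fixTangent Γ x, vorticityCentre n lam u = 0 → u = 0)
    (hsymp : ∀ p ∈ Γ, ∀ ε : ℝ, (ε = 1 ∨ ε = -1) → (∀ i, lam (p.2 i) = ε * lam i) →
      ε * LinearMap.det (p.1.toLinearEquiv : R3 →ₗ[ℝ] R3) = 1)
    {ξ : R3} (hξ : ξ ∈ fixMomentum lam Γ)
    (hmult : ∀ v : Fin n → R3, (∀ i, ⟪v i, x i⟫ = 0) →
      fderiv ℝ (vortexH n lam) x v = ⟪ξ, ∑ i, lam i • v i⟫) (i : Fin n) :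
    cross ξ (x i) = 0 := by
  refine congr_fun (hinj (fun i => cross ξ (x i))
    ⟨fun i => inner_cross_self_right _ _, fun p hp i => ?_⟩ ?_) i
  · obtain ⟨ε, hε, h⟩ := hlam p hp
    have hdet := hsymp p hp ε hε h
    refine ext_inner_right ℝ fun c => ?_
    obtain ⟨c, rfl⟩ := p.1.surjective c
    rw [p.1.inner_map_map, ← one_mul ⟪_, c⟫, ← hdet, mul_assoc, ← inner_cross_map, hξ p hp ε hε h,
      hx.2.2 p hp, inner_cross, inner_cross, real_inner_smul_left]
    rcases hε with rfl | rfl <;> simp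
  · refine ext_inner_right ℝ fun c => ?_
    have h := hmult (fun i => cross (x i) c) fun i => inner_cross_self_left _ _
    rw [fderiv_vortexH_cross lam hx.2.1, inner_sum] at h
    simp only [vorticityCentre, sum_inner, real_inner_smul_left, inner_cross, inner_zero_left]
    simpa only [real_inner_smul_right] using h.symm

end Symmetry

/-- an isolated point of `Fix(Γ) ∩ Φ⁻¹(μ)` is a relative equilibrium; if
moreover `Γ` consists of symplectic elements (`ε · det A = 1`), it is a fixed equilibrium
(Theorem 3.6). -/
theorem isolated_symmetric_point_is_relative_equilibrium (n : ℕ) (hn : 2 ≤ n)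
    (lam : Fin n → ℝ)
    (Γ : Set ((R3 ≃ₗᵢ[ℝ] R3) × Equiv.Perm (Fin n)))
    (hid : (LinearIsometryEquiv.refl ℝ R3, (1 : Equiv.Perm (Fin n))) ∈ Γ)
    (hmul : ∀ p ∈ Γ, ∀ q ∈ Γ,
      ((Prod.fst q).trans (Prod.fst p), (Prod.snd q) * (Prod.snd p)) ∈ Γ)
    (hinv : ∀ p ∈ Γ, ((Prod.fst p).symm, (Prod.snd p)⁻¹) ∈ Γ)
    (hlamΓ : ∀ p ∈ Γ, ((fun i => lam (Prod.snd p i)) = lam ∨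
      (fun i => lam (Prod.snd p i)) = fun i => -lam i))
    (x : Fin n → R3) (hx : x ∈ fixSet n Γ)
    (hisol : ∃ U : Set (Fin n → R3), IsOpen U ∧ x ∈ U ∧
      (fixSet n Γ ∩ {y | vorticityCentre n lam y = vorticityCentre n lam x}) ∩ U = {x}) :
    (∃ ξ : R3, ∀ v : Fin n → R3, (∀ i, ⟪v i, x i⟫ = 0) →
      fderiv ℝ (vortexH n lam) x v = ⟪ξ, ∑ i, lam i • v i⟫) ∧
    ((∀ p ∈ Γ, ∀ ε : ℝ, (ε = 1 ∨ ε = -1) →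
        ((fun i => lam (Prod.snd p i)) = fun i => ε * lam i) →
        ε * LinearMap.det ((Prod.fst p).toLinearEquiv : R3 →ₗ[ℝ] R3) = 1) →
      ∀ v : Fin n → R3, (∀ i, ⟪v i, x i⟫ = 0) → fderiv ℝ (vortexH n lam) x v = 0) := by
  have hlam : ∀ p ∈ Γ, ∃ ε : ℝ, (ε = 1 ∨ ε = -1) ∧ ∀ i, lam (p.2 i) = ε * lam i := by
    intro p hp
    rcases hlamΓ p hp with h | h
    · exact ⟨1, Or.inl rfl, fun i => by simpa using congr_fun h i⟩
    · exact ⟨-1, Or.inr rfl, fun i => by simpa using congr_fun h i⟩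
  have hisol' : ∀ᶠ y in 𝓝 x, y ∈ fixSet n Γ →
      vorticityCentre n lam y = vorticityCentre n lam x → y = x := by
    obtain ⟨U, hU, hxU, hUeq⟩ := hisol
    filter_upwards [hU.mem_nhds hxU] with y hyU hy hμ
    exact hUeq.subset ⟨⟨hy, hμ⟩, hyU⟩
  by_cases hpar : ∀ i j, lam i ≠ 0 → lam j ≠ 0 → x i = x j ∨ x i = -x j
  · have hcrit := fderiv_vortexH_of_parallel lam hx.2.1 hpar
    exact ⟨⟨0, fun v hv => by rw [hcrit v hv, inner_zero_left]⟩, fun _ => hcrit⟩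
  push Not at hpar
  obtain ⟨i, j, hi, hj, hij, hij'⟩ := hpar
  have hinj : ∀ u ∈ fixTangent Γ x, vorticityCentre n lam u = 0 → u = 0 := fun u hu =>
    eq_zero_of_isolated hx hlam
      (fun w => eq_zero_of_momentumField_eq_zero hx.1 hi hj hij hij') hisol' hu
  obtain ⟨ξ, hξ, hmult⟩ := exists_multiplier hx hlam hinj
  refine ⟨⟨ξ, hmult⟩, fun hsymp v hv => ?_⟩
  have hcross := cross_multiplier_eq_zero hx hlam hinj
    (fun p hp ε hε h => hsymp p hp ε hε (funext h)) hξ hmult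
  rw [hmult v hv, inner_sum]
  refine Finset.sum_eq_zero fun k _ => ?_
  have h := inner_cross_cross ξ (x k) (v k)
  rw [hcross k, inner_zero_left, hv k, real_inner_self_eq_norm_sq, hx.1 k] at h
  rw [real_inner_smul_right, show ⟪ξ, v k⟫ = 0 by linarith, mul_zero]
end
end

section
/- Symmetry of the angular velocity (Proposition 3.3): Let n ≥ 2, λ : Fin n → ℝ, and let x : Fin n → ℝ³ be a configuration (‖x i‖ = 1 for all i, x i ≠ x j for i ≠ j) that is a relative equilibrium with angular velocity ξ ∈ ℝ³, i.e. F(x) i = ξ × x i for all i. Assume there exist indices i, j such that x i and x j are linearly independent. Then for every linear isometry A of ℝ³, every permutation σ of Fin n and every ε ∈ {1, −1} such that λ (σ i) = ε · λ i and A (x (σ i)) = x i for all i, one has A ξ = ε • ξ. -/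
open scoped RealInnerProductSpace BigOperators

noncomputable section

theorem inner_eq_coords (u v : R3) : ⟪u, v⟫ = u 0 * v 0 + u 1 * v 1 + u 2 * v 2 := by
  simp only [PiLp.inner_apply, Fin.sum_univ_three, RCLike.inner_apply, conj_trivial]
  ring

theorem cross_apply_zero (u v : R3) : cross u v 0 = u 1 * v 2 - u 2 * v 1 := rfl

theorem cross_apply_one (u v : R3) : cross u v 1 = u 2 * v 0 - u 0 * v 2 := rfl

theorem cross_apply_two (u v : R3) : cross u v 2 = u 0 * v 1 - u 1 * v 0 := rfl

theorem linearMap_apply_coords (A : R3 →ₗ[ℝ] R3) (u : R3) (k : Fin 3) :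
    A u k = u 0 * A (v3 1 0 0) k + u 1 * A (v3 0 1 0) k + u 2 * A (v3 0 0 1) k := by
  have h : u = u 0 • v3 1 0 0 + u 1 • v3 0 1 0 + u 2 • v3 0 0 1 := by
    ext i
    fin_cases i <;> simp [v3]
  conv_lhs => rw [h]
  simp

/-- A linear isometry of `R3` is compatible with the cross product up to its determinant. -/
theorem exists_cross_map_eq_smul (A : R3 →ₗᵢ[ℝ] R3) :
    ∃ d : ℝ, ∀ u v, cross (A u) (A v) = d • A (cross u v) := by
  refine ⟨⟪cross (A (v3 1 0 0)) (A (v3 0 1 0)), A (v3 0 0 1)⟫, fun u v => ?_⟩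
  have hsurj : Function.Surjective A :=
    LinearMap.surjective_of_injective (f := A.toLinearMap) A.injective
  refine ext_inner_right ℝ fun z => ?_
  obtain ⟨w, rfl⟩ := hsurj z
  rw [inner_smul_left, A.inner_map_map]
  have hA : ∀ (u : R3) (k : Fin 3), A u k =
      u 0 * A (v3 1 0 0) k + u 1 * A (v3 0 1 0) k + u 2 * A (v3 0 0 1) k :=
    linearMap_apply_coords A.toLinearMap
  simp only [inner_eq_coords, cross_apply_zero, cross_apply_one, cross_apply_two, conj_trivial]
  rw [hA u 0, hA u 1, hA u 2, hA v 0, hA v 1, hA v 2, hA w 0, hA w 1, hA w 2]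
  ring

theorem cross_sub_smul_left (a b u : R3) (c : ℝ) :
    cross (a - c • b) u = cross a u - c • cross b u := by
  ext k
  fin_cases k <;> simp [cross, v3] <;> ring

/-- A vector whose cross products with two linearly independent vectors vanish is zero. -/
theorem eq_zero_of_cross_eq_zero {w u v : R3} (h : LinearIndependent ℝ ![u, v])
    (hu : cross w u = 0) (hv : cross w v = 0) : w = 0 := by
  by_contra hw
  have key : ∀ z : R3, cross w z = 0 → ⟪w, w⟫ • z = ⟪w, z⟫ • w := by
    intro z hz
    have h0 : w 1 * z 2 - w 2 * z 1 = 0 := congrArg (fun t : R3 => t 0) hz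
    have h1 : w 2 * z 0 - w 0 * z 2 = 0 := congrArg (fun t : R3 => t 1) hz
    have h2 : w 0 * z 1 - w 1 * z 0 = 0 := congrArg (fun t : R3 => t 2) hz
    ext k
    rw [inner_eq_coords, inner_eq_coords]
    fin_cases k <;> simp only [PiLp.smul_apply, smul_eq_mul, Fin.zero_eta, Fin.mk_one, Fin.reduceFinMk]
    · linear_combination w 2 * h1 - w 1 * h2
    · linear_combination w 0 * h2 - w 2 * h0
    · linear_combination w 1 * h0 - w 0 * h1
  have hww : ⟪w, w⟫ ≠ 0 := inner_self_ne_zero.mpr hw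
  have hpair := LinearIndependent.pair_iff.mp h
  have hrel := hpair (⟪w, v⟫ * ⟪w, w⟫) (-(⟪w, u⟫ * ⟪w, w⟫)) (by
    rw [neg_smul, mul_smul, mul_smul, key u hu, key v hv, smul_smul, smul_smul, mul_comm,
      add_neg_cancel])
  have hwv : ⟪w, v⟫ = 0 := (mul_eq_zero.mp hrel.1).resolve_right hww
  have hv0 : v = 0 := by
    have := key v hv
    rw [hwv, zero_smul] at this
    exact (smul_eq_zero.mp this).resolve_left hww
  exact h.ne_zero 1 hv0

/-- Equivariance of the vortex vector field under a symmetry of the configuration. -/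
theorem smul_map_vortexF {ι : Type} [Fintype ι] [DecidableEq ι] {lam : ι → ℝ} {x : ι → R3}
    {A : R3 →ₗᵢ[ℝ] R3} {σ : Equiv.Perm ι} {ε d : ℝ}
    (hd : ∀ u v, cross (A u) (A v) = d • A (cross u v))
    (hlam : ∀ i, lam (σ i) = ε * lam i) (hfix : ∀ i, A (x (σ i)) = x i) (i : ι) :
    d • A (vortexF lam x (σ i)) = ε • vortexF lam x i := by
  simp only [vortexF, map_sum, Finset.smul_sum, Finset.sum_filter]
  rw [← Equiv.sum_comp σ]
  refine Finset.sum_congr rfl fun j _ => ?_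
  by_cases hj : j = i
  · simp [hj]
  have hσ : σ j ≠ σ i := fun h => hj (σ.injective h)
  rw [if_pos hσ, if_pos hj, map_smul, smul_comm, ← hd, hfix, hfix, hlam,
    ← A.inner_map_map, hfix, hfix, smul_smul, mul_div_assoc]

/-- symmetry of the angular velocity of a relative equilibrium
(Proposition 3.3): if `(A, σ, ε)` is a symmetry of the relative equilibrium `x`
with angular velocity `ξ`, then `A ξ = ε • ξ`. -/
theorem angular_velocity_symmetry (n : ℕ) (hn : 2 ≤ n) (lam : Fin n → ℝ)
    (x : Fin n → R3)
    (hnorm : ∀ i, ‖x i‖ = 1) (hdist : ∀ i j, i ≠ j → x i ≠ x j)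
    (ξ : R3) (hre : ∀ i, vortexF lam x i = cross ξ (x i))
    (hind : ∃ i j, LinearIndependent ℝ ![x i, x j])
    (A : R3 →ₗᵢ[ℝ] R3) (σ : Equiv.Perm (Fin n)) (ε : ℝ) (hε : ε = 1 ∨ ε = -1)
    (hlam : ∀ i, lam (σ i) = ε * lam i)
    (hfix : ∀ i, A (x (σ i)) = x i) :
    A ξ = ε • ξ := by
  obtain ⟨d, hd⟩ := exists_cross_map_eq_smul A
  obtain ⟨i, j, hij⟩ := hind
  have hcross : ∀ k, cross (A ξ - ε • ξ) (x k) = 0 := by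
    intro k
    have h := smul_map_vortexF hd hlam hfix k
    rw [hre, hre, ← hd, hfix] at h
    rw [cross_sub_smul_left, h, sub_self]
  exact sub_eq_zero.mp (eq_zero_of_cross_eq_zero hij (hcross i) (hcross j))
end
end

section
/- The angular velocity of a relative equilibrium is parallel to the momentum vector (Proposition 3.4): Let n ≥ 2, λ : Fin n → ℝ, and let x : Fin n → ℝ³ be a configuration (‖x i‖ = 1 for all i, x i ≠ x j for i ≠ j). If x is a relative equilibrium with angular velocity ξ ∈ ℝ³, i.e. F(x) i = ξ × x i for all i, then ξ × Φ(x) = 0, where Φ(x) = Σ_i λ i • x i. -/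
open scoped RealInnerProductSpace BigOperators

noncomputable section

/-- `cross` as a linear map in its second argument. -/
def crossLinear (u : R3) : R3 →ₗ[ℝ] R3 where
  toFun := cross u
  map_add' v w := by
    ext k
    fin_cases k <;> simp [cross, v3] <;> ring
  map_smul' c v := by
    ext k
    fin_cases k <;> simp [cross, v3] <;> ring

theorem cross_sum_smul {ι : Type*} (s : Finset ι) (u : R3) (c : ι → ℝ) (v : ι → R3) :
    cross u (∑ i ∈ s, c i • v i) = ∑ i ∈ s, c i • cross u (v i) := by
  exact (map_sum (crossLinear u) _ s).trans
    (Finset.sum_congr rfl fun i _ => map_smul (crossLinear u) (c i) (v i))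

theorem cross_eq_neg_cross (u v : R3) : cross u v = -cross v u := by
  ext k
  fin_cases k <;> simp [cross, v3] <;> ring

/-- The vortex field preserves the centre of vorticity. -/
theorem sum_smul_vortexF {ι : Type} [Fintype ι] [DecidableEq ι] (lam : ι → ℝ) (x : ι → R3) :
    ∑ i, lam i • vortexF lam x i = 0 := by
  have : IsAddTorsionFree R3 := .of_module_rat R3
  refine self_eq_neg.mp ?_
  simp only [vortexF, Finset.smul_sum, Finset.sum_filter]
  conv_lhs => rw [Finset.sum_comm]
  simp only [← Finset.sum_neg_distrib]
  refine Finset.sum_congr rfl fun i _ => Finset.sum_congr rfl fun j _ => ?_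
  by_cases h : i = j
  · simp [h]
  · rw [if_pos h, if_pos (Ne.symm h), cross_eq_neg_cross, real_inner_comm, smul_neg, smul_neg,
      smul_smul, smul_smul]
    congr 2
    ring

/-- the angular velocity of a relative equilibrium is parallel to the
centre of vorticity (Proposition 3.4). -/
theorem angular_velocity_parallel_momentum (n : ℕ) (hn : 2 ≤ n) (lam : Fin n → ℝ)
    (x : Fin n → R3)
    (hnorm : ∀ i, ‖x i‖ = 1) (hdist : ∀ i j, i ≠ j → x i ≠ x j)
    (ξ : R3) (hre : ∀ i, vortexF lam x i = cross ξ (x i)) :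
    cross ξ (vorticityCentre n lam x) = 0 := by
  rw [vorticityCentre, cross_sum_smul]
  simpa only [hre] using sum_smul_vortexF lam x
end
end

section
/- The aligned double ring D_{Nh}(2R) is a relative equilibrium with explicit angular velocity (Theorem 3.7 and Proposition 3.8, case without poles): Let N ≥ 2 and θ ∈ (0, π/2). Consider the configuration of n = 2N vortices with positions p j = (sin θ · cos (2πj/N), sin θ · sin (2πj/N), cos θ) of vorticity +1 and q j = (sin θ · cos (2πj/N), sin θ · sin (2πj/N), −cos θ) of vorticity −1, for j = 0, …, N−1. Set ξ = cos θ · [ (N−1)/sin²θ + Σ_{j=0}^{N−1} (1 + cos (2πj/N)) / (2 − sin²θ · (1 + cos (2πj/N))) ]. Then F(x) i = ξ • ((0,0,1) × x i) for every vortex x i of the configuration; in particular the configuration is a relative equilibrium rotating about the z-axis with angular velocity ξ. -/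
open scoped RealInnerProductSpace BigOperators

noncomputable section

/-- A function with period `2π` has the same sum over the `N`-th roots of unity after rotating
by one of them. -/
lemma sum_periodic_shift {N : ℕ} (f : ℝ → ℝ) (hf : Function.Periodic f (2 * Real.pi))
    (i : Fin N) :
    ∑ j : Fin N, f (2 * Real.pi * ((j : ℕ) : ℝ) / (N : ℝ) - 2 * Real.pi * ((i : ℕ) : ℝ) / (N : ℝ)) =
      ∑ j : Fin N, f (2 * Real.pi * ((j : ℕ) : ℝ) / (N : ℝ)) := by
  have : NeZero N := ⟨fun h => by subst h; exact i.elim0⟩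
  have hN : (N : ℝ) ≠ 0 := NeZero.ne _
  rw [← Equiv.sum_comp (Equiv.subRight i) (fun j : Fin N => f (2 * Real.pi * ((j : ℕ) : ℝ) / N))]
  refine Finset.sum_congr rfl fun j _ => ?_
  simp only [Equiv.subRight_apply]
  rcases le_or_gt i j with h | h
  · rw [Fin.sub_val_of_le h, Nat.cast_sub h]
    congr 1
    ring
  · have hv : ((j - i : Fin N) : ℕ) = N + j - i := Fin.coe_sub_iff_lt.mpr h
    have hle : (i : ℕ) ≤ N + j := by omega
    rw [hv, Nat.cast_sub hle, Nat.cast_add, ← hf]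
    congr 1
    field_simp
    ring

/-- An odd function with period `2π` sums to zero over the `N`-th roots of unity. -/
lemma sum_periodic_odd {N : ℕ} (f : ℝ → ℝ) (hf : Function.Periodic f (2 * Real.pi))
    (hodd : ∀ t, f (-t) = -f t) :
    ∑ j : Fin N, f (2 * Real.pi * ((j : ℕ) : ℝ) / (N : ℝ)) = 0 := by
  rcases Nat.eq_zero_or_pos N with rfl | hpos
  · simp
  have : NeZero N := ⟨hpos.ne'⟩
  have hN : (N : ℝ) ≠ 0 := NeZero.ne _
  have key : ∑ j : Fin N, f (2 * Real.pi * ((j : ℕ) : ℝ) / (N : ℝ)) =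
      ∑ j : Fin N, -f (2 * Real.pi * ((j : ℕ) : ℝ) / (N : ℝ)) := by
    rw [← Equiv.sum_comp (Equiv.neg (Fin N))
      (fun j : Fin N => f (2 * Real.pi * ((j : ℕ) : ℝ) / N))]
    refine Finset.sum_congr rfl fun j _ => ?_
    simp only [Equiv.neg_apply]
    rw [← hodd]
    by_cases hj : j = 0
    · simp [hj]
    · rw [Fin.val_neg, if_neg hj, Nat.cast_sub j.isLt.le, ← hf (-_)]
      congr 1
      field_simp
      ring
  rw [Finset.sum_neg_distrib] at key
  linarith

lemma cos_sub_ne_one_of_ne {N : ℕ} {i j : Fin N} (h : j ≠ i) :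
    Real.cos (2 * Real.pi * ((j : ℕ) : ℝ) / (N : ℝ) - 2 * Real.pi * ((i : ℕ) : ℝ) / (N : ℝ)) ≠ 1 := by
  have hN : (0 : ℝ) < N := by exact_mod_cast i.pos
  have hi : ((i : ℕ) : ℝ) < N := by exact_mod_cast i.isLt
  have hj : ((j : ℕ) : ℝ) < N := by exact_mod_cast j.isLt
  have hi0 : (0 : ℝ) ≤ ((i : ℕ) : ℝ) := Nat.cast_nonneg _
  have hj0 : (0 : ℝ) ≤ ((j : ℕ) : ℝ) := Nat.cast_nonneg _
  have hpi := Real.pi_pos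
  have heq : 2 * Real.pi * ((j : ℕ) : ℝ) / (N : ℝ) - 2 * Real.pi * ((i : ℕ) : ℝ) / (N : ℝ) =
      2 * Real.pi * ((((j : ℕ) : ℝ) - ((i : ℕ) : ℝ)) / N) := by ring
  rw [heq]
  intro hc
  have hlt : (((j : ℕ) : ℝ) - ((i : ℕ) : ℝ)) / N < 1 := by rw [div_lt_one hN]; linarith
  have hgt : -1 < (((j : ℕ) : ℝ) - ((i : ℕ) : ℝ)) / N := by rw [lt_div_iff₀ hN]; linarith
  rw [Real.cos_eq_one_iff_of_lt_of_lt (by nlinarith) (by nlinarith)] at hc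
  have h0 : ((j : ℕ) : ℝ) - ((i : ℕ) : ℝ) = 0 := by
    rcases mul_eq_zero.mp hc with h' | h'
    · linarith
    · exact (div_eq_zero_iff.mp h').resolve_right hN.ne'
  exact h (Fin.ext (by exact_mod_cast sub_eq_zero.mp h0))

lemma inner_v3 (a b c a' b' c' : ℝ) :
    ⟪v3 a b c, v3 a' b' c'⟫ = a * a' + b * b' + c * c' := by
  simp [v3, PiLp.inner_apply, Fin.sum_univ_three]
  ring

lemma cross_self_eq_zero (u : R3) : cross u u = 0 := by
  ext k
  fin_cases k <;> simp [cross, v3] <;> ring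

lemma vortexF_eq_sum {ι : Type} [Fintype ι] [DecidableEq ι] (lam : ι → ℝ) (x : ι → R3) (i : ι) :
    vortexF lam x i = ∑ j, (lam j / (1 - ⟪x i, x j⟫)) • cross (x j) (x i) := by
  refine Finset.sum_subset (Finset.filter_subset _ _) fun j _ hj => ?_
  have hji : j = i := by simpa using hj
  rw [hji, cross_self_eq_zero, smul_zero]

/-- The velocity induced at the point of azimuth `a` and height `σ c` by a vortex of strength `τ`,
azimuth `b` and height `τ c`, split into its azimuthal and meridional parts. -/
lemma vortex_pair_velocity (s c a b σ τ : ℝ) (hτ : τ * τ = 1) :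
    (τ / (1 - ⟪v3 (s * Real.cos a) (s * Real.sin a) (σ * c),
        v3 (s * Real.cos b) (s * Real.sin b) (τ * c)⟫)) •
      cross (v3 (s * Real.cos b) (s * Real.sin b) (τ * c))
        (v3 (s * Real.cos a) (s * Real.sin a) (σ * c)) =
    (c * ((1 - σ * τ * Real.cos (b - a)) /
        (1 - σ * τ * c ^ 2 - s ^ 2 * Real.cos (b - a)))) •
      cross (v3 0 0 1) (v3 (s * Real.cos a) (s * Real.sin a) (σ * c)) +
    (τ * Real.sin (b - a) / (1 - σ * τ * c ^ 2 - s ^ 2 * Real.cos (b - a))) •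
      v3 (σ * c * s * Real.cos a) (σ * c * s * Real.sin a) (-s ^ 2) := by
  have hin : 1 - ⟪v3 (s * Real.cos a) (s * Real.sin a) (σ * c),
        v3 (s * Real.cos b) (s * Real.sin b) (τ * c)⟫ =
      1 - σ * τ * c ^ 2 - s ^ 2 * Real.cos (b - a) := by
    rw [inner_v3, Real.cos_sub]
    ring
  rw [hin]
  generalize (1 - σ * τ * c ^ 2 - s ^ 2 * Real.cos (b - a)) = d
  rw [Real.cos_sub, Real.sin_sub]
  have ha := Real.sin_sq_add_cos_sq a
  ext k
  fin_cases k <;> simp [cross, v3]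
  · linear_combination (d⁻¹ * -(c * s * Real.sin a)) * hτ
      - (d⁻¹ * τ * σ * c * s * Real.sin b) * ha
  · linear_combination (d⁻¹ * (c * s * Real.cos a)) * hτ
      + (d⁻¹ * τ * σ * c * s * Real.cos b) * ha
  · ring

/-- Velocity induced by a whole ring: the meridional parts cancel. -/
lemma ring_velocity {N : ℕ} (s c σ τ : ℝ) (hτ : τ * τ = 1) (i : Fin N) :
    ∑ j : Fin N, (τ / (1 - ⟪v3 (s * Real.cos (2 * Real.pi * ((i : ℕ) : ℝ) / (N : ℝ)))
          (s * Real.sin (2 * Real.pi * ((i : ℕ) : ℝ) / (N : ℝ))) (σ * c),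
        v3 (s * Real.cos (2 * Real.pi * ((j : ℕ) : ℝ) / (N : ℝ)))
          (s * Real.sin (2 * Real.pi * ((j : ℕ) : ℝ) / (N : ℝ))) (τ * c)⟫)) •
      cross (v3 (s * Real.cos (2 * Real.pi * ((j : ℕ) : ℝ) / (N : ℝ)))
          (s * Real.sin (2 * Real.pi * ((j : ℕ) : ℝ) / (N : ℝ))) (τ * c))
        (v3 (s * Real.cos (2 * Real.pi * ((i : ℕ) : ℝ) / (N : ℝ)))
          (s * Real.sin (2 * Real.pi * ((i : ℕ) : ℝ) / (N : ℝ))) (σ * c)) =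
    (c * ∑ j : Fin N, (1 - σ * τ * Real.cos (2 * Real.pi * ((j : ℕ) : ℝ) / (N : ℝ)
            - 2 * Real.pi * ((i : ℕ) : ℝ) / (N : ℝ))) /
        (1 - σ * τ * c ^ 2 - s ^ 2 * Real.cos (2 * Real.pi * ((j : ℕ) : ℝ) / (N : ℝ)
            - 2 * Real.pi * ((i : ℕ) : ℝ) / (N : ℝ)))) •
      cross (v3 0 0 1) (v3 (s * Real.cos (2 * Real.pi * ((i : ℕ) : ℝ) / (N : ℝ)))
          (s * Real.sin (2 * Real.pi * ((i : ℕ) : ℝ) / (N : ℝ))) (σ * c)) := by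
  simp_rw [vortex_pair_velocity s c _ _ σ τ hτ]
  have hper : Function.Periodic
      (fun t => τ * Real.sin t / (1 - σ * τ * c ^ 2 - s ^ 2 * Real.cos t)) (2 * Real.pi) :=
    fun t => by simp
  rw [Finset.sum_add_distrib, ← Finset.sum_smul, ← Finset.sum_smul, ← Finset.mul_sum,
    sum_periodic_shift _ hper i, sum_periodic_odd _ hper (fun t => by simp [neg_div]),
    zero_smul, add_zero]

/-- The azimuthal sum for a vortex and its own ring. -/
lemma same_ring_sum {N : ℕ} {s c : ℝ} (hsc : s ^ 2 + c ^ 2 = 1) (i : Fin N) :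
    ∑ j : Fin N, (1 - Real.cos (2 * Real.pi * ((j : ℕ) : ℝ) / (N : ℝ)
            - 2 * Real.pi * ((i : ℕ) : ℝ) / (N : ℝ))) /
        (1 - c ^ 2 - s ^ 2 * Real.cos (2 * Real.pi * ((j : ℕ) : ℝ) / (N : ℝ)
            - 2 * Real.pi * ((i : ℕ) : ℝ) / (N : ℝ))) = ((N : ℝ) - 1) / s ^ 2 := by
  have hterm : ∀ j ∈ Finset.univ.erase i, (1 - Real.cos (2 * Real.pi * ((j : ℕ) : ℝ) / (N : ℝ)
            - 2 * Real.pi * ((i : ℕ) : ℝ) / (N : ℝ))) /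
        (1 - c ^ 2 - s ^ 2 * Real.cos (2 * Real.pi * ((j : ℕ) : ℝ) / (N : ℝ)
            - 2 * Real.pi * ((i : ℕ) : ℝ) / (N : ℝ))) = 1 / s ^ 2 := by
    intro j hj
    have hne := sub_ne_zero.mpr (cos_sub_ne_one_of_ne (Finset.ne_of_mem_erase hj)).symm
    rw [show ∀ C : ℝ, 1 - c ^ 2 - s ^ 2 * C = s ^ 2 * (1 - C) by
      intro C; linear_combination -hsc]
    rw [div_mul_cancel_right₀ hne, one_div]
  rw [← Finset.add_sum_erase _ _ (Finset.mem_univ i), Finset.sum_congr rfl hterm]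
  have hN : 1 ≤ N := i.pos
  simp [Finset.card_erase_of_mem, Nat.cast_sub hN, div_eq_mul_inv]

/-- The azimuthal sum for a vortex and the opposite ring. -/
lemma opposite_ring_sum {N : ℕ} {s c : ℝ} (hsc : s ^ 2 + c ^ 2 = 1) (i : Fin N) :
    ∑ j : Fin N, (1 + Real.cos (2 * Real.pi * ((j : ℕ) : ℝ) / (N : ℝ)
            - 2 * Real.pi * ((i : ℕ) : ℝ) / (N : ℝ))) /
        (1 + c ^ 2 - s ^ 2 * Real.cos (2 * Real.pi * ((j : ℕ) : ℝ) / (N : ℝ)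
            - 2 * Real.pi * ((i : ℕ) : ℝ) / (N : ℝ))) =
      ∑ j : Fin N, (1 + Real.cos (2 * Real.pi * ((j : ℕ) : ℝ) / (N : ℝ))) /
        (2 - s ^ 2 * (1 + Real.cos (2 * Real.pi * ((j : ℕ) : ℝ) / (N : ℝ)))) := by
  rw [sum_periodic_shift (fun t => (1 + Real.cos t) / (1 + c ^ 2 - s ^ 2 * Real.cos t))
    (fun t => by simp) i]
  refine Finset.sum_congr rfl fun j _ => ?_
  congr 1
  linear_combination hsc

/-- the aligned double ring `D_{Nh}(2R)` is a relative equilibrium rotating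
about the `z`-axis with the explicit angular velocity of Proposition 3.8 (no poles). -/
theorem DNh_double_ring_relative_equilibrium (N : ℕ) (hN : 2 ≤ N)
    (θ : ℝ) (hθ : θ ∈ Set.Ioo 0 (Real.pi / 2))
    (lam : Fin N ⊕ Fin N → ℝ) (x : Fin N ⊕ Fin N → R3) (ξ : ℝ)
    (hlamp : ∀ j : Fin N, lam (Sum.inl j) = 1)
    (hlamm : ∀ j : Fin N, lam (Sum.inr j) = -1)
    (hxp : ∀ j : Fin N, x (Sum.inl j) =
      v3 (Real.sin θ * Real.cos (2 * Real.pi * ((j : ℕ) : ℝ) / (N : ℝ)))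
         (Real.sin θ * Real.sin (2 * Real.pi * ((j : ℕ) : ℝ) / (N : ℝ)))
         (Real.cos θ))
    (hxm : ∀ j : Fin N, x (Sum.inr j) =
      v3 (Real.sin θ * Real.cos (2 * Real.pi * ((j : ℕ) : ℝ) / (N : ℝ)))
         (Real.sin θ * Real.sin (2 * Real.pi * ((j : ℕ) : ℝ) / (N : ℝ)))
         (-Real.cos θ))
    (hξ : ξ = Real.cos θ * (((N : ℝ) - 1) / Real.sin θ ^ 2 +
      ∑ j : Fin N, (1 + Real.cos (2 * Real.pi * ((j : ℕ) : ℝ) / (N : ℝ))) /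
        (2 - Real.sin θ ^ 2 * (1 + Real.cos (2 * Real.pi * ((j : ℕ) : ℝ) / (N : ℝ)))))) :
    ∀ i, vortexF lam x i = ξ • cross (v3 0 0 1) (x i) := by
  have hsc := Real.sin_sq_add_cos_sq θ
  rintro (i | i)
  · have h₁ := ring_velocity (Real.sin θ) (Real.cos θ) 1 1 (by norm_num) i
    have h₂ := ring_velocity (Real.sin θ) (Real.cos θ) 1 (-1) (by norm_num) i
    simp only [one_mul, neg_mul, sub_neg_eq_add, same_ring_sum hsc, opposite_ring_sum hsc]
      at h₁ h₂
    rw [vortexF_eq_sum, Fintype.sum_sum_type]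
    simp only [hlamp, hlamm, hxp, hxm]
    rw [h₁, h₂, ← add_smul, ← mul_add, ← hξ]
  · have h₁ := ring_velocity (Real.sin θ) (Real.cos θ) (-1) 1 (by norm_num) i
    have h₂ := ring_velocity (Real.sin θ) (Real.cos θ) (-1) (-1) (by norm_num) i
    simp only [one_mul, mul_one, neg_mul, neg_neg, sub_neg_eq_add, same_ring_sum hsc,
      opposite_ring_sum hsc] at h₁ h₂
    rw [vortexF_eq_sum, Fintype.sum_sum_type]
    simp only [hlamp, hlamm, hxp, hxm]
    rw [h₁, h₂, ← add_smul, ← mul_add, add_comm (∑ j : Fin N, _), ← hξ]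
end
end
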